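/- Let φ be a 3-form on ℝ^8 whose reduced trace form b^φ is non-degenerate (i.e. φ is stable). Define a bilinear bracket [·,·]_φ on ℝ^8 by requiring b^φ([X,Y]_φ, Z) = φ(X,Y,Z) for all Z ∈ ℝ^8. Then [·,·]_φ is antisymmetric and satisfies the Jacobi identity, so that (ℝ^8, [·,·]_φ) is a Lie algebra. -/

import Mathlib

noncomputable section

/-- The wedge product of real-valued alternating forms (via `AlternatingMap.domCoprod`). -/
def awedge {V : Type*} [AddCommGroup V] [Module ℝ V] {p q : ℕ}
    (α : V [⋀^Fin p]→ₗ[ℝ] ℝ) (β : V [⋀^Fin q]→ₗ[ℝ] ℝ) : V [⋀^Fin (p + q)]→ₗ[ℝ] ℝ :=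
  ((TensorProduct.lid ℝ ℝ).toLinearMap.compAlternatingMap (α.domCoprod β)).domDomCongr
    finSumFinEquiv

/-- The standard volume form `θ = e^1 ∧ ⋯ ∧ e^8` on `ℝ⁸`: the determinant form on the
standard basis. -/
def volForm : (Fin 8 → ℝ) [⋀^Fin 8]→ₗ[ℝ] ℝ := Matrix.detRowAlternating

/-- `mul` is the reduced multiplication of the 3-form `ω`: for all `v, w`, the vector
`v·w = mul v w` satisfies `(v·w) ⌟ θ = (v ⌟ ω) ∧ (w ⌟ ω) ∧ ω`, where `⌟` is insertion in
the first slot. -/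
def IsReducedMul (ω : (Fin 8 → ℝ) [⋀^Fin 3]→ₗ[ℝ] ℝ)
    (mul : (Fin 8 → ℝ) →ₗ[ℝ] (Fin 8 → ℝ) →ₗ[ℝ] (Fin 8 → ℝ)) : Prop :=
  ∀ v w : Fin 8 → ℝ,
    volForm.curryLeft (mul v w) = awedge (awedge (ω.curryLeft v) (ω.curryLeft w)) ω

/-- The reduced trace form `b^ω(v,w) = Tr (L_v ∘ L_w)`, where `L_v(w) = v·w = mul v w`. -/
def reducedTraceForm (mul : (Fin 8 → ℝ) →ₗ[ℝ] (Fin 8 → ℝ) →ₗ[ℝ] (Fin 8 → ℝ))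
    (v w : Fin 8 → ℝ) : ℝ :=
  LinearMap.trace ℝ (Fin 8 → ℝ) (mul v ∘ₗ mul w)


open Module AlternatingMap

local notation "𝕍" => Fin 8 → ℝ

section Wedge

variable {V W : Type*} [AddCommGroup V] [Module ℝ V] [AddCommGroup W] [Module ℝ W] {p q : ℕ}

/-- The wedge product as a bilinear map. -/
def awedgeBilin (V : Type*) [AddCommGroup V] [Module ℝ V] (p q : ℕ) :
    (V [⋀^Fin p]→ₗ[ℝ] ℝ) →ₗ[ℝ] (V [⋀^Fin q]→ₗ[ℝ] ℝ) →ₗ[ℝ] (V [⋀^Fin (p + q)]→ₗ[ℝ] ℝ) :=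
  LinearMap.mk₂ ℝ awedge
    (fun _ _ _ => by
      ext; simp only [awedge, ← domCoprod'_apply, TensorProduct.add_tmul, map_add]; simp)
    (fun _ _ _ => by
      ext; simp only [awedge, ← domCoprod'_apply, ← TensorProduct.smul_tmul', map_smul]; simp)
    (fun _ _ _ => by
      ext; simp only [awedge, ← domCoprod'_apply, TensorProduct.tmul_add, map_add]; simp)
    (fun _ _ _ => by
      ext; simp only [awedge, ← domCoprod'_apply, TensorProduct.tmul_smul, map_smul]; simp)

@[simp]
theorem awedgeBilin_apply (α : V [⋀^Fin p]→ₗ[ℝ] ℝ) (β : V [⋀^Fin q]→ₗ[ℝ] ℝ) :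
    awedgeBilin V p q α β = awedge α β := rfl

theorem awedge_compLinearMap (α : V [⋀^Fin p]→ₗ[ℝ] ℝ) (β : V [⋀^Fin q]→ₗ[ℝ] ℝ)
    (g : W →ₗ[ℝ] V) :
    awedge (α.compLinearMap g) (β.compLinearMap g) = (awedge α β).compLinearMap g := by
  ext v
  simp only [awedge, domDomCongr_apply, LinearMap.compAlternatingMap_apply, domCoprod_apply,
    compLinearMap_apply, sum_apply]
  congr 1
  refine Finset.sum_congr rfl fun σ _ => ?_
  induction σ using Quotient.inductionOn'
  simp [domCoprod.summand_mk'', MultilinearMap.domCoprod_apply, MultilinearMap.domDomCongr_apply]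

end Wedge

theorem det_compLinearMap {ι M : Type*} [Fintype ι] [DecidableEq ι] [AddCommGroup M] [Module ℝ M]
    (e : Basis ι ℝ M) (g : M →ₗ[ℝ] M) : e.det.compLinearMap g = LinearMap.det g • e.det := by
  ext v
  exact e.det_comp g v

theorem det_vecCons_single_succAbove {n : ℕ} (u : Fin (n + 1) → ℝ) (i : Fin (n + 1)) :
    Matrix.det (Matrix.of (Matrix.vecCons u fun k => Pi.single (i.succAbove k) 1)) =
      (-1) ^ (i : ℕ) * u i := by
  rw [Matrix.det_succ_row_zero, Finset.sum_eq_single i]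
  · have : Matrix.submatrix
        (Matrix.of (Matrix.vecCons u fun k => Pi.single (i.succAbove k) (1 : ℝ)))
          Fin.succ i.succAbove = 1 := by
      ext a b
      simp [Matrix.one_apply, Pi.single_apply, eq_comm]
    rw [this]
    simp
  · intro j _ hj
    obtain ⟨k, hk⟩ := Fin.exists_succAbove_eq hj
    rw [Matrix.det_eq_zero_of_row_eq_zero k, mul_zero]
    intro b
    simp [hk, Fin.succAbove_ne]
  · simp

section DetCurry

variable {n : ℕ}

theorem detRowAlternating_curryLeft_succAbove (u : Fin (n + 1) → ℝ) (i : Fin (n + 1)) :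
    (Matrix.detRowAlternating (R := ℝ)).curryLeft u (fun k => Pi.single (i.succAbove k) 1) =
      (-1) ^ (i : ℕ) * u i :=
  det_vecCons_single_succAbove u i

/-- An `n`-form on `ℝⁿ⁺¹` is determined by its values on ordered basis tuples. -/
theorem codimOneForm_ext {α β : (Fin (n + 1) → ℝ) [⋀^Fin n]→ₗ[ℝ] ℝ}
    (h : ∀ i : Fin (n + 1), α (fun k => Pi.single (i.succAbove k) 1) =
      β fun k => Pi.single (i.succAbove k) 1) : α = β := by
  refine (Pi.basisFun ℝ (Fin (n + 1))).ext_alternating fun v hv => ?_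
  obtain ⟨i, hi⟩ : ∃ i, ∀ k, v k ≠ i := by
    by_contra! hs
    have := Fintype.card_le_of_surjective v hs
    simp at this
  choose τ hτ using fun k => Fin.exists_succAbove_eq (hi k)
  have hinj : Function.Injective τ := fun a b hab => hv (by rw [← hτ a, ← hτ b, hab])
  let σ : Equiv.Perm (Fin n) := Equiv.ofBijective τ (Finite.injective_iff_bijective.1 hinj)
  have hσ : (fun k => Pi.basisFun ℝ (Fin (n + 1)) (v k)) =
      (fun k => (Pi.single (i.succAbove k) 1 : Fin (n + 1) → ℝ)) ∘ σ := by
    funext k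
    simp [σ, hτ]
  rw [hσ, map_perm, map_perm, h]

theorem detRowAlternating_curryLeft_bijective :
    Function.Bijective (Matrix.detRowAlternating (n := Fin (n + 1)) (R := ℝ)).curryLeft := by
  constructor
  · intro u u' h
    funext i
    have := DFunLike.congr_fun h fun k => Pi.single (i.succAbove k) 1
    rw [detRowAlternating_curryLeft_succAbove, detRowAlternating_curryLeft_succAbove] at this
    exact mul_left_cancel₀ (by simp) this
  · intro α
    refine ⟨fun i => (-1) ^ (i : ℕ) * α fun k => Pi.single (i.succAbove k) 1,
      codimOneForm_ext fun i => ?_⟩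
    rw [detRowAlternating_curryLeft_succAbove, ← mul_assoc, ← mul_pow]
    simp

/-- Contraction with the determinant form, as an isomorphism from vectors of `ℝⁿ⁺¹` to
`n`-forms. -/
def detCurryEquiv (n : ℕ) : (Fin (n + 1) → ℝ) ≃ₗ[ℝ] (Fin (n + 1) → ℝ) [⋀^Fin n]→ₗ[ℝ] ℝ :=
  LinearEquiv.ofBijective _ detRowAlternating_curryLeft_bijective

theorem detCurryEquiv_apply (u : Fin (n + 1) → ℝ) :
    detCurryEquiv n u = (Matrix.detRowAlternating (R := ℝ)).curryLeft u := rfl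

theorem detRowAlternating_curryLeft_eq_iff {u : Fin (n + 1) → ℝ}
    {β : (Fin (n + 1) → ℝ) [⋀^Fin n]→ₗ[ℝ] ℝ} :
    (Matrix.detRowAlternating (R := ℝ)).curryLeft u = β ↔ u = (detCurryEquiv n).symm β :=
  (detCurryEquiv n).eq_symm_apply.symm

theorem detCurryEquiv_symm_compLinearMap (β : (Fin (n + 1) → ℝ) [⋀^Fin n]→ₗ[ℝ] ℝ)
    (g : (Fin (n + 1) → ℝ) ≃ₗ[ℝ] Fin (n + 1) → ℝ) :
    (detCurryEquiv n).symm (β.compLinearMap g.toLinearMap) =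
      LinearMap.det g.toLinearMap • g.symm ((detCurryEquiv n).symm β) := by
  obtain ⟨u, rfl⟩ := (detCurryEquiv n).surjective β
  obtain ⟨u, rfl⟩ := g.surjective u
  rw [LinearEquiv.symm_apply_eq, map_smul, LinearEquiv.symm_apply_apply,
    LinearEquiv.symm_apply_apply, detCurryEquiv_apply, detCurryEquiv_apply]
  refine (curryLeft_compLinearMap g.toLinearMap _ u).symm.trans ?_
  rw [← Pi.basisFun_det, det_compLinearMap, curryLeft_smul]
  rfl

end DetCurry

/-- The polarised reduced multiplication: the vector whose contraction with the volume form is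
`(v ⌟ α) ∧ (w ⌟ β) ∧ γ`. -/
def polarMul (α β γ : 𝕍 [⋀^Fin 3]→ₗ[ℝ] ℝ) : 𝕍 →ₗ[ℝ] 𝕍 →ₗ[ℝ] 𝕍 :=
  LinearMap.compr₂ ((awedgeBilin 𝕍 2 2).compl₁₂ α.curryLeft β.curryLeft)
    ((detCurryEquiv (2 + 2 + 3)).symm.toLinearMap ∘ₗ (awedgeBilin 𝕍 (2 + 2) 3).flip γ)

/-- The reduced multiplication of a `3`-form. -/
def reducedMul (φ : 𝕍 [⋀^Fin 3]→ₗ[ℝ] ℝ) : 𝕍 →ₗ[ℝ] 𝕍 →ₗ[ℝ] 𝕍 := polarMul φ φ φ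

theorem polarMul_apply (α β γ : 𝕍 [⋀^Fin 3]→ₗ[ℝ] ℝ) (v w : 𝕍) :
    polarMul α β γ v w =
      (detCurryEquiv (2 + 2 + 3)).symm (awedge (awedge (α.curryLeft v) (β.curryLeft w)) γ) := by
  rw [polarMul, LinearMap.compr₂_apply, LinearMap.compl₁₂_apply, LinearMap.comp_apply,
    LinearMap.flip_apply, awedgeBilin_apply, awedgeBilin_apply]
  rfl

theorem isReducedMul_iff {φ : 𝕍 [⋀^Fin 3]→ₗ[ℝ] ℝ} {mul : 𝕍 →ₗ[ℝ] 𝕍 →ₗ[ℝ] 𝕍} :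
    IsReducedMul φ mul ↔ mul = reducedMul φ := by
  rw [LinearMap.ext_iff₂]
  refine forall₂_congr fun v w => ?_
  rw [reducedMul, polarMul_apply, volForm, detRowAlternating_curryLeft_eq_iff]

/-- The reduced trace form of a `3`-form, as a bilinear form. -/
def traceForm (φ : 𝕍 [⋀^Fin 3]→ₗ[ℝ] ℝ) : 𝕍 →ₗ[ℝ] 𝕍 →ₗ[ℝ] ℝ :=
  ((LinearMap.mul ℝ (Module.End ℝ 𝕍)).compr₂ (LinearMap.trace ℝ 𝕍)).compl₁₂
    (reducedMul φ) (reducedMul φ)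

theorem traceForm_apply (φ : 𝕍 [⋀^Fin 3]→ₗ[ℝ] ℝ) (v w : 𝕍) :
    traceForm φ v w = reducedTraceForm (reducedMul φ) v w := rfl

theorem traceForm_comm (φ : 𝕍 [⋀^Fin 3]→ₗ[ℝ] ℝ) (v w : 𝕍) :
    traceForm φ v w = traceForm φ w v :=
  LinearMap.trace_mul_comm ℝ (reducedMul φ v) (reducedMul φ w)

theorem reducedMul_compLinearMap (φ : 𝕍 [⋀^Fin 3]→ₗ[ℝ] ℝ) (g : 𝕍 ≃ₗ[ℝ] 𝕍) (v w : 𝕍) :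
    reducedMul (φ.compLinearMap g.toLinearMap) v w =
      LinearMap.det g.toLinearMap • g.symm (reducedMul φ (g v) (g w)) := by
  rw [reducedMul, polarMul_apply, curryLeft_compLinearMap, curryLeft_compLinearMap,
    awedge_compLinearMap, awedge_compLinearMap, reducedMul, polarMul_apply,
    detCurryEquiv_symm_compLinearMap]
  simp only [LinearEquiv.coe_coe]

theorem traceForm_compLinearMap (φ : 𝕍 [⋀^Fin 3]→ₗ[ℝ] ℝ) (g : 𝕍 ≃ₗ[ℝ] 𝕍) (v w : 𝕍) :
    traceForm (φ.compLinearMap g.toLinearMap) v w =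
      LinearMap.det g.toLinearMap ^ 2 * traceForm φ (g v) (g w) := by
  have h (v : 𝕍) : reducedMul (φ.compLinearMap g.toLinearMap) v =
      LinearMap.det g.toLinearMap • g.symm.conj (reducedMul φ (g v)) := by
    refine LinearMap.ext fun w => ?_
    rw [reducedMul_compLinearMap]
    simp [LinearEquiv.conj_apply]
  rw [traceForm_apply, traceForm_apply, reducedTraceForm, reducedTraceForm, h, h,
    LinearMap.smul_comp,
    LinearMap.comp_smul, ← LinearEquiv.conj_comp, map_smul, map_smul, LinearMap.trace_conj']
  simp [pow_two, mul_assoc]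

/-- A `3`-form as a trilinear map. -/
def trilin (φ : 𝕍 [⋀^Fin 3]→ₗ[ℝ] ℝ) : 𝕍 →ₗ[ℝ] 𝕍 →ₗ[ℝ] 𝕍 →ₗ[ℝ] ℝ :=
  LinearMap.mk₂ ℝ
    (fun X Y =>
      { toFun := fun Z => φ ![X, Y, Z]
        map_add' := fun Z Z' => ((φ.curryLeft X).curryLeft Y).map_vecCons_add ![] Z Z'
        map_smul' := fun c Z => ((φ.curryLeft X).curryLeft Y).map_vecCons_smul ![] c Z })
    (fun X X' Y => LinearMap.ext fun Z => φ.map_vecCons_add ![Y, Z] X X')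
    (fun c X Y => LinearMap.ext fun Z => φ.map_vecCons_smul ![Y, Z] c X)
    (fun X Y Y' => LinearMap.ext fun Z => (φ.curryLeft X).map_vecCons_add ![Z] Y Y')
    (fun c X Y => LinearMap.ext fun Z => (φ.curryLeft X).map_vecCons_smul ![Z] c Y)

theorem trilin_apply (φ : 𝕍 [⋀^Fin 3]→ₗ[ℝ] ℝ) (X Y Z : 𝕍) : trilin φ X Y Z = φ ![X, Y, Z] := rfl

theorem trilin_swap (φ : 𝕍 [⋀^Fin 3]→ₗ[ℝ] ℝ) (X Y Z : 𝕍) :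
    trilin φ Y X Z = -trilin φ X Y Z := by
  have h := φ.map_swap ![X, Y, Z] (show (0 : Fin 3) ≠ 1 by decide)
  rw [trilin_apply, trilin_apply, ← h]
  congr 1
  ext i : 1
  fin_cases i <;> rfl

theorem form_ext {φ ψ : 𝕍 [⋀^Fin 3]→ₗ[ℝ] ℝ} (h : ∀ x y z, trilin φ x y z = trilin ψ x y z) :
    φ = ψ := by
  ext v
  have hv : v = ![v 0, v 1, v 2] := by ext i : 1; fin_cases i <;> rfl
  rw [hv]
  exact h _ _ _

theorem trilin_compLinearMap (φ : 𝕍 [⋀^Fin 3]→ₗ[ℝ] ℝ) (g : 𝕍 →ₗ[ℝ] 𝕍) (x y z : 𝕍) :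
    trilin (φ.compLinearMap g) x y z = trilin φ (g x) (g y) (g z) := by
  rw [trilin_apply, trilin_apply, compLinearMap_apply]
  congr 1
  ext i : 1
  fin_cases i <;> rfl

/-- Non-degeneracy of a bilinear form, in the left variable. -/
def IsNondeg (b : 𝕍 →ₗ[ℝ] 𝕍 →ₗ[ℝ] ℝ) : Prop := ∀ v, (∀ w, b v w = 0) → v = 0

/-- The Jacobi identity for a bilinear bracket. -/
def IsJacobi (br : 𝕍 →ₗ[ℝ] 𝕍 →ₗ[ℝ] 𝕍) : Prop :=
  ∀ X Y Z, br X (br Y Z) + br Y (br Z X) + br Z (br X Y) = 0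

/-- Every bracket dual to the `3`-form `φ` with respect to its reduced trace form satisfies the
Jacobi identity, provided that the trace form is non-degenerate. -/
def IsLieForm (φ : 𝕍 [⋀^Fin 3]→ₗ[ℝ] ℝ) : Prop :=
  IsNondeg (traceForm φ) → ∀ br : 𝕍 →ₗ[ℝ] 𝕍 →ₗ[ℝ] 𝕍,
    (∀ X Y Z, traceForm φ (br X Y) Z = trilin φ X Y Z) → IsJacobi br

theorem IsNondeg.ext {b : 𝕍 →ₗ[ℝ] 𝕍 →ₗ[ℝ] ℝ} (hb : IsNondeg b) {v v' : 𝕍}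
    (h : ∀ w, b v w = b v' w) : v = v' :=
  sub_eq_zero.1 (hb _ fun w => by rw [map_sub, LinearMap.sub_apply, h, sub_self])

theorem IsNondeg.exists_bracket {b : 𝕍 →ₗ[ℝ] 𝕍 →ₗ[ℝ] ℝ} (hb : IsNondeg b)
    (T : 𝕍 →ₗ[ℝ] 𝕍 →ₗ[ℝ] 𝕍 →ₗ[ℝ] ℝ) :
    ∃ br : 𝕍 →ₗ[ℝ] 𝕍 →ₗ[ℝ] 𝕍, ∀ X Y Z, b (br X Y) Z = T X Y Z := by
  have hinj : Function.Injective b := fun v v' h => hb.ext fun w => by rw [h]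
  let E : 𝕍 ≃ₗ[ℝ] (𝕍 →ₗ[ℝ] ℝ) :=
    LinearEquiv.ofInjectiveOfFinrankEq b hinj (Subspace.dual_finrank_eq (K := ℝ) (V := 𝕍)).symm
  refine ⟨T.compr₂ E.symm.toLinearMap, fun X Y Z => ?_⟩
  change E (E.symm (T X Y)) Z = _
  rw [E.apply_symm_apply]

theorem IsLieForm.compLinearMap {φ : 𝕍 [⋀^Fin 3]→ₗ[ℝ] ℝ} (h : IsLieForm φ) (g : 𝕍 ≃ₗ[ℝ] 𝕍) :
    IsLieForm (φ.compLinearMap g.toLinearMap) := by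
  intro hnd br hbr
  set d := LinearMap.det g.toLinearMap with hd
  have hd0 : d ≠ 0 := (LinearEquiv.isUnit_det' g).ne_zero
  have hnd' : IsNondeg (traceForm φ) := fun v hv => by
    rw [← g.symm.map_eq_zero_iff]
    refine hnd _ fun w => ?_
    rw [traceForm_compLinearMap, g.apply_symm_apply, hv, mul_zero]
  have key := h hnd' ((d ^ 2) • (br.compl₁₂ g.symm.toLinearMap g.symm.toLinearMap).compr₂
    g.toLinearMap) fun X Y Z => by
      have := hbr (g.symm X) (g.symm Y) (g.symm Z)
      rw [traceForm_compLinearMap, trilin_compLinearMap] at this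
      simpa using this
  intro X Y Z
  have := key (g X) (g Y) (g Z)
  simp only [LinearMap.smul_apply, LinearMap.compr₂_apply, LinearMap.compl₁₂_apply,
    LinearEquiv.coe_coe, LinearEquiv.symm_apply_apply, map_smul, ← smul_add, ← map_add] at this
  simpa only [smul_eq_zero, pow_eq_zero_iff two_ne_zero, hd0, false_or,
    LinearEquiv.map_eq_zero_iff] using this

section StructureConstants

variable {R S ι : Type*} [CommRing R] [CommRing S] [Fintype ι] [DecidableEq ι]

/-- The Gram matrix `Tr (L_i L_j)` of the multiplication with structure constants `m`. -/
def gram (m : ι → ι → ι → R) : Matrix ι ι R :=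
  Matrix.of fun i j => ∑ k, ∑ l, m j k l * m i l k

/-- The bracket dual to `f` with respect to the Gram matrix of `m`, multiplied by the determinant
of the latter. -/
def adjBracket (m f : ι → ι → ι → R) (i j l : ι) : R :=
  ∑ k, (gram m).adjugate l k * f i j k

/-- The coordinates of the cyclic sum in the Jacobi identity. -/
def jacobiator (n : ι → ι → ι → R) (i j k l : ι) : R :=
  ∑ p, (n j k p * n i p l + n k i p * n j p l + n i j p * n k p l)

/-- The polynomial expressing the Jacobi identity for the bracket dual to `f`. -/
def jacobiPoly (m f : ι → ι → ι → R) (i j k l : ι) : R :=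
  (gram m).det * jacobiator (adjBracket m f) i j k l

theorem map_gram (e : R →+* S) (m : ι → ι → ι → R) :
    e.mapMatrix (gram m) = gram fun i j k => e (m i j k) := by
  ext i j
  simp [gram]

theorem map_jacobiPoly (e : R →+* S) (m f : ι → ι → ι → R) (i j k l : ι) :
    e (jacobiPoly m f i j k l) =
      jacobiPoly (fun i j k => e (m i j k)) (fun i j k => e (f i j k)) i j k l := by
  have h (i j : ι) :
      e ((gram m).adjugate i j) = (gram fun i j k => e (m i j k)).adjugate i j := by
    rw [← map_gram, ← RingHom.map_adjugate]
    rfl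
  simp only [jacobiPoly, jacobiator, adjBracket, map_mul, map_sum, map_add, h, RingHom.map_det,
    map_gram]

end StructureConstants

/-- The structure constants of the reduced multiplication. -/
def mulCoeff (φ : 𝕍 [⋀^Fin 3]→ₗ[ℝ] ℝ) (i j k : Fin 8) : ℝ :=
  reducedMul φ (Pi.single i 1) (Pi.single j 1) k

/-- The coefficients of a `3`-form. -/
def formCoeff (φ : 𝕍 [⋀^Fin 3]→ₗ[ℝ] ℝ) (i j k : Fin 8) : ℝ :=
  trilin φ (Pi.single i 1) (Pi.single j 1) (Pi.single k 1)

theorem pi_eq_sum_smul (v : 𝕍) : v = ∑ i, v i • (Pi.single i 1 : 𝕍) := by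
  conv_lhs => rw [← Finset.univ_sum_single v]
  refine Finset.sum_congr rfl fun i _ => ?_
  rw [← Pi.single_smul, smul_eq_mul, mul_one]

theorem traceForm_single (φ : 𝕍 [⋀^Fin 3]→ₗ[ℝ] ℝ) (i j : Fin 8) :
    traceForm φ (Pi.single i 1) (Pi.single j 1) = gram (mulCoeff φ) i j := by
  rw [traceForm_apply, reducedTraceForm, LinearMap.trace_eq_matrix_trace ℝ (Pi.basisFun ℝ (Fin 8)),
    Matrix.trace, gram, Matrix.of_apply]
  refine Finset.sum_congr rfl fun k _ => ?_
  rw [Matrix.diag_apply, LinearMap.toMatrix_apply, Pi.basisFun_apply, LinearMap.comp_apply,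
    Pi.basisFun_repr, pi_eq_sum_smul (reducedMul φ (Pi.single j 1) (Pi.single k 1)), map_sum,
    Finset.sum_apply]
  simp [mulCoeff]

theorem traceForm_mulVec (φ : 𝕍 [⋀^Fin 3]→ₗ[ℝ] ℝ) (v : 𝕍) (k : Fin 8) :
    traceForm φ v (Pi.single k 1) = (gram (mulCoeff φ)).mulVec v k := by
  rw [traceForm_comm]
  conv_lhs => rw [pi_eq_sum_smul v, map_sum]
  simp [Matrix.mulVec, dotProduct, traceForm_single, mul_comm]

theorem isNondeg_traceForm_iff (φ : 𝕍 [⋀^Fin 3]→ₗ[ℝ] ℝ) :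
    IsNondeg (traceForm φ) ↔ (gram (mulCoeff φ)).det ≠ 0 := by
  have h (v : 𝕍) : (∀ w, traceForm φ v w = 0) ↔ (gram (mulCoeff φ)).mulVec v = 0 := by
    constructor
    · intro hv
      funext k
      rw [← traceForm_mulVec, hv, Pi.zero_apply]
    · intro hv w
      rw [pi_eq_sum_smul w, map_sum]
      simp [traceForm_mulVec, hv]
  rw [Ne, ← Matrix.exists_mulVec_eq_zero_iff]
  simp only [IsNondeg, h]
  grind

theorem adjBracket_eq {φ : 𝕍 [⋀^Fin 3]→ₗ[ℝ] ℝ} {br : 𝕍 →ₗ[ℝ] 𝕍 →ₗ[ℝ] 𝕍}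
    (hbr : ∀ X Y Z, traceForm φ (br X Y) Z = trilin φ X Y Z) (i j l : Fin 8) :
    adjBracket (mulCoeff φ) (formCoeff φ) i j l =
      (gram (mulCoeff φ)).det * br (Pi.single i 1) (Pi.single j 1) l := by
  have h : formCoeff φ i j =
      (gram (mulCoeff φ)).mulVec (br (Pi.single i 1) (Pi.single j 1)) := by
    funext k
    rw [← traceForm_mulVec, hbr, formCoeff]
  change (gram (mulCoeff φ)).adjugate.mulVec (formCoeff φ i j) l = _
  rw [h, Matrix.mulVec_mulVec, Matrix.adjugate_mul, Matrix.smul_mulVec, Matrix.one_mulVec,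
    Pi.smul_apply, smul_eq_mul]

theorem jacobiPoly_eq {φ : 𝕍 [⋀^Fin 3]→ₗ[ℝ] ℝ} {br : 𝕍 →ₗ[ℝ] 𝕍 →ₗ[ℝ] 𝕍}
    (hbr : ∀ X Y Z, traceForm φ (br X Y) Z = trilin φ X Y Z) (i j k l : Fin 8) :
    jacobiPoly (mulCoeff φ) (formCoeff φ) i j k l = (gram (mulCoeff φ)).det ^ 3 *
      (br (Pi.single i 1) (br (Pi.single j 1) (Pi.single k 1)) +
        br (Pi.single j 1) (br (Pi.single k 1) (Pi.single i 1)) +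
        br (Pi.single k 1) (br (Pi.single i 1) (Pi.single j 1))) l := by
  have h (v w : 𝕍) : br v w l = ∑ p, w p * br v (Pi.single p 1) l := by
    conv_lhs => rw [pi_eq_sum_smul w, map_sum]
    simp
  rw [jacobiPoly, jacobiator, Pi.add_apply, Pi.add_apply, h _ (br _ _), h _ (br _ _),
    h _ (br _ _), ← Finset.sum_add_distrib, ← Finset.sum_add_distrib, Finset.mul_sum,
    Finset.mul_sum]
  refine Finset.sum_congr rfl fun p _ => ?_
  simp only [adjBracket_eq hbr]
  ring

theorem isJacobi_of_single {br : 𝕍 →ₗ[ℝ] 𝕍 →ₗ[ℝ] 𝕍}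
    (h : ∀ i j k : Fin 8, br (Pi.single i 1) (br (Pi.single j 1) (Pi.single k 1)) +
        br (Pi.single j 1) (br (Pi.single k 1) (Pi.single i 1)) +
        br (Pi.single k 1) (br (Pi.single i 1) (Pi.single j 1)) = 0) : IsJacobi br := by
  have step (Y Z : 𝕍) (hYZ : ∀ i : Fin 8, br (Pi.single i 1) (br Y Z) +
      br Y (br Z (Pi.single i 1)) + br Z (br (Pi.single i 1) Y) = 0) (X : 𝕍) :
      br X (br Y Z) + br Y (br Z X) + br Z (br X Y) = 0 := by
    have : br.flip (br Y Z) + br Y ∘ₗ br Z + br Z ∘ₗ br.flip Y = 0 :=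
      (Pi.basisFun ℝ (Fin 8)).ext fun i => by simpa using hYZ i
    simpa using LinearMap.congr_fun this X
  intro X Y Z
  refine step Y Z (fun i => ?_) X
  rw [add_comm, ← add_assoc]
  refine step _ Y (fun j => ?_) Z
  rw [add_comm, ← add_assoc]
  exact step _ _ (fun k => h k j i) Y

theorem isLieForm_iff (φ : 𝕍 [⋀^Fin 3]→ₗ[ℝ] ℝ) :
    IsLieForm φ ↔ ∀ i j k l, jacobiPoly (mulCoeff φ) (formCoeff φ) i j k l = 0 := by
  constructor
  · intro h i j k l
    by_cases hd : (gram (mulCoeff φ)).det = 0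
    · rw [jacobiPoly, hd, zero_mul]
    · have hnd := (isNondeg_traceForm_iff φ).2 hd
      obtain ⟨br, hbr⟩ := hnd.exists_bracket (trilin φ)
      rw [jacobiPoly_eq hbr, h hnd br hbr, Pi.zero_apply, mul_zero]
  · intro h hnd br hbr
    refine isJacobi_of_single fun i j k => funext fun l => ?_
    have := h i j k l
    rw [jacobiPoly_eq hbr] at this
    exact (mul_eq_zero.1 this).resolve_left (pow_ne_zero _ ((isNondeg_traceForm_iff φ).1 hnd))

theorem isJacobi_of_invariant {b : 𝕍 →ₗ[ℝ] 𝕍 →ₗ[ℝ] ℝ} (hb : IsNondeg b)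
    {φ : 𝕍 [⋀^Fin 3]→ₗ[ℝ] ℝ} {c br : 𝕍 →ₗ[ℝ] 𝕍 →ₗ[ℝ] 𝕍}
    (hbr : ∀ X Y Z, b (br X Y) Z = trilin φ X Y Z) (hc : ∀ x y, c x y = -c y x)
    (hbc : ∀ w u v, b (c w u) v + b u (c w v) = 0)
    (hφc : ∀ w x y z, trilin φ (c w x) y z + trilin φ x (c w y) z + trilin φ x y (c w z) = 0)
    (hassoc : ∀ x y z w, trilin φ (c x y) z w = trilin φ x y (c z w))
    (hspan : Submodule.span ℝ (Set.range fun p : 𝕍 × 𝕍 => c p.1 p.2) = ⊤) : IsJacobi br := by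
  have h1 (x y z : 𝕍) : br (c x y) z = -c z (br x y) := hb.ext fun w => by
    rw [hbr, hassoc, ← hbr, map_neg, LinearMap.neg_apply]
    linarith [hbc z (br x y) w]
  have h2 (w x y : 𝕍) : c w (br x y) = br (c w x) y + br x (c w y) := hb.ext fun z => by
    rw [map_add, LinearMap.add_apply, hbr, hbr]
    linarith [hbc w (br x y) z, hφc w x y z, hbr x y (c w z)]
  have hanti (x y : 𝕍) : br x y = -br y x := hb.ext fun z => by
    rw [map_neg, LinearMap.neg_apply, hbr, hbr, trilin_swap]
  intro X Y Z
  have hZ : Z ∈ Submodule.span ℝ (Set.range fun p : 𝕍 × 𝕍 => c p.1 p.2) := hspan ▸ trivial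
  induction hZ using Submodule.span_induction with
  | mem Z hZ =>
    obtain ⟨⟨u, v⟩, rfl⟩ := hZ
    have h3 (x : 𝕍) : c (br u v) x = br (c u v) x := by rw [hc, h1]
    dsimp only
    rw [h1 u v (br X Y), ← hc, h2, h3, h3, hanti Y (br _ _), hanti Y (c u v), map_neg]
    abel
  | zero => simp
  | add Z Z' _ _ h h' =>
    simp only [map_add, LinearMap.add_apply]
    linear_combination (exp := 1) h + h'
  | smul r Z _ h =>
    simp only [map_smul, LinearMap.smul_apply, ← smul_add, h, smul_zero]

/-- The representative of a class of `3 × 3` matrices modulo scalars with vanishing central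
entry. -/
def toMat : 𝕍 →ₗ[ℝ] Matrix (Fin 3) (Fin 3) ℝ where
  toFun x := !![x 6, x 0, x 5; x 3, 0, x 1; x 2, x 4, -x 7]
  map_add' x y := by ext i j; fin_cases i <;> fin_cases j <;> simp [add_comm]
  map_smul' r x := by ext i j; fin_cases i <;> fin_cases j <;> simp

/-- The coordinates of a `3 × 3` matrix modulo scalars. -/
def ofMat : Matrix (Fin 3) (Fin 3) ℝ →ₗ[ℝ] 𝕍 where
  toFun X := ![X 0 1, X 1 2, X 2 0, X 1 0, X 2 1, X 0 2, X 0 0 - X 1 1, X 1 1 - X 2 2]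
  map_add' X Y := by ext i; fin_cases i <;> simp <;> ring
  map_smul' r X := by ext i; fin_cases i <;> simp <;> ring

theorem ofMat_toMat (x : 𝕍) : ofMat (toMat x) = x := by
  ext i; fin_cases i <;> simp [ofMat, toMat]

theorem toMat_ofMat (X : Matrix (Fin 3) (Fin 3) ℝ) : toMat (ofMat X) = X - X 1 1 • 1 := by
  ext i j; fin_cases i <;> fin_cases j <;> simp [ofMat, toMat]

theorem ofMat_one : ofMat 1 = 0 := by
  ext i; fin_cases i <;> simp [ofMat]

/-- The `3`-form `e^i ∧ e^j ∧ e^k`. -/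
def coordForm (i j k : Fin 8) : 𝕍 [⋀^Fin 3]→ₗ[ℝ] ℝ :=
  (Matrix.detRowAlternating (R := ℝ)).compLinearMap (LinearMap.funLeft ℝ ℝ ![i, j, k])

theorem trilin_coordForm (i j k : Fin 8) (x y z : 𝕍) :
    trilin (coordForm i j k) x y z =
      x i * y j * z k - x i * y k * z j - x j * y i * z k + x j * y k * z i + x k * y i * z j
        - x k * y j * z i := by
  have : trilin (coordForm i j k) x y z = Matrix.det (Matrix.of
    fun a b => ![x, y, z] a (![i, j, k] b)) := rfl
  rw [this, Matrix.det_fin_three]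
  simp

/-- The Cartan `3`-form of `sl₃(ℝ)`, in the coordinates of `toMat`. -/
def modelForm : 𝕍 [⋀^Fin 3]→ₗ[ℝ] ℝ :=
  coordForm 0 1 2 - coordForm 3 4 5 + coordForm 0 3 6 + coordForm 1 4 7
    - coordForm 2 5 6 - coordForm 2 5 7

theorem trilin_modelForm (x y z : 𝕍) :
    trilin modelForm x y z = trilin (coordForm 0 1 2) x y z - trilin (coordForm 3 4 5) x y z
      + trilin (coordForm 0 3 6) x y z + trilin (coordForm 1 4 7) x y z
      - trilin (coordForm 2 5 6) x y z - trilin (coordForm 2 5 7) x y z := rfl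

theorem trilin_modelForm_ofMat (X Y Z : Matrix (Fin 3) (Fin 3) ℝ) :
    trilin modelForm (ofMat X) (ofMat Y) (ofMat Z) = ((X * Y - Y * X) * Z).trace := by
  simp only [trilin_modelForm, trilin_coordForm, Matrix.trace_fin_three,
    Matrix.mul_apply, Matrix.sub_apply, Fin.sum_univ_three]
  simp [ofMat]
  ring

/-- Conjugation of matrices modulo scalars. -/
def conjEquiv (g : (Matrix (Fin 3) (Fin 3) ℝ)ˣ) : 𝕍 ≃ₗ[ℝ] 𝕍 :=
  LinearEquiv.ofLinearMap
    (ofMat ∘ₗ LinearMap.mulLeftRight ℝ (g.val, g.inv) ∘ₗ toMat)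
    (ofMat ∘ₗ LinearMap.mulLeftRight ℝ (g.inv, g.val) ∘ₗ toMat)
    (LinearMap.ext fun x => by
      simp [toMat_ofMat, mul_sub, sub_mul, mul_assoc, ofMat_one, ofMat_toMat])
    (LinearMap.ext fun x => by
      simp [toMat_ofMat, mul_sub, sub_mul, mul_assoc, ofMat_one, ofMat_toMat])

theorem conjEquiv_ofMat (g : (Matrix (Fin 3) (Fin 3) ℝ)ˣ) (X : Matrix (Fin 3) (Fin 3) ℝ) :
    conjEquiv g (ofMat X) = ofMat (g.val * X * g.inv) := by
  simp [conjEquiv, toMat_ofMat, mul_sub, sub_mul, ofMat_one]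

theorem modelForm_conjEquiv (g : (Matrix (Fin 3) (Fin 3) ℝ)ˣ) :
    modelForm.compLinearMap (conjEquiv g).toLinearMap = modelForm := by
  refine form_ext fun x y z => ?_
  rw [trilin_compLinearMap]
  simp only [LinearEquiv.coe_coe]
  rw [← ofMat_toMat x, ← ofMat_toMat y, ← ofMat_toMat z, conjEquiv_ofMat, conjEquiv_ofMat,
    conjEquiv_ofMat, trilin_modelForm_ofMat, trilin_modelForm_ofMat,
      ← Matrix.trace_units_conj g (_ * toMat z)]
  congr 1
  simp [mul_assoc, mul_sub, sub_mul]

theorem det_sq_eq_one {φ : 𝕍 [⋀^Fin 3]→ₗ[ℝ] ℝ} (hφ : IsNondeg (traceForm φ)) (g : 𝕍 ≃ₗ[ℝ] 𝕍)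
    (hg : φ.compLinearMap g.toLinearMap = φ) : LinearMap.det g.toLinearMap ^ 2 = 1 := by
  set d := LinearMap.det g.toLinearMap with hd
  have h : traceForm φ = d ^ 2 • (traceForm φ).compl₁₂ g.toLinearMap g.toLinearMap := by
    refine LinearMap.ext₂ fun v w => ?_
    conv_lhs => rw [← hg, traceForm_compLinearMap]
    rfl
  have hG : LinearMap.toMatrix₂' ℝ (traceForm φ) = gram (mulCoeff φ) := by
    ext i j
    rw [LinearMap.toMatrix₂'_apply, traceForm_single]
  have hdet := congr_arg (fun b => (LinearMap.toMatrix₂' ℝ b).det) h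
  rw [map_smul, LinearMap.toMatrix₂'_compl₁₂, Matrix.det_smul, Matrix.det_mul, Matrix.det_mul,
    Matrix.det_transpose, LinearMap.det_toMatrix', ← hd, hG, Fintype.card_fin] at hdet
  have h0 := (isNondeg_traceForm_iff φ).1 hφ
  have h18 : (d ^ 2) ^ 9 = 1 := mul_right_cancel₀ h0 (by linear_combination -hdet)
  exact (pow_eq_one_iff_of_nonneg (sq_nonneg d) (by norm_num)).1 h18

theorem traceForm_conj (hnd : IsNondeg (traceForm modelForm)) (g : (Matrix (Fin 3) (Fin 3) ℝ)ˣ)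
    (X Y : Matrix (Fin 3) (Fin 3) ℝ) :
    traceForm modelForm (ofMat (g.val * X * g.inv)) (ofMat (g.val * Y * g.inv)) =
      traceForm modelForm (ofMat X) (ofMat Y) := by
  have h := traceForm_compLinearMap modelForm (conjEquiv g) (ofMat X) (ofMat Y)
  rw [det_sq_eq_one hnd _ (modelForm_conjEquiv g), one_mul, modelForm_conjEquiv, conjEquiv_ofMat,
    conjEquiv_ofMat] at h
  exact h.symm

theorem traceForm_commutator_of_sq_eq_zero (hnd : IsNondeg (traceForm modelForm))
    {E : Matrix (Fin 3) (Fin 3) ℝ} (hE : E * E = 0) (X Y : Matrix (Fin 3) (Fin 3) ℝ) :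
    traceForm modelForm (ofMat (E * X - X * E)) (ofMat Y) +
      traceForm modelForm (ofMat X) (ofMat (E * Y - Y * E)) = 0 := by
  have h (s : ℝ) := by
    have hinv : (1 + s • E) * (1 - s • E) = 1 := by simp [mul_sub, add_mul, hE]
    have hinv' : (1 - s • E) * (1 + s • E) = 1 := by simp [mul_add, sub_mul, hE]
    have hconj (X : Matrix (Fin 3) (Fin 3) ℝ) :
        (1 + s • E) * X * (1 - s • E) = X + s • (E * X - X * E) - s ^ 2 • (E * X * E) := by
      simp only [mul_sub, add_mul, mul_one, one_mul, smul_mul_assoc,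
        mul_smul_comm, smul_sub, smul_add, pow_two, mul_smul]
      abel
    have := traceForm_conj hnd ⟨_, _, hinv, hinv'⟩ X Y
    simp only [hconj, map_add, map_sub, map_smul, LinearMap.add_apply, LinearMap.sub_apply,
      LinearMap.smul_apply, smul_eq_mul] at this
    exact this
  simp only [map_sub, LinearMap.sub_apply]
  linear_combination (2 / 3 : ℝ) * h 1 - (2 / 3 : ℝ) * h (-1) - (1 / 12 : ℝ) * h 2
    + (1 / 12 : ℝ) * h (-2)

theorem traceForm_commutator (hnd : IsNondeg (traceForm modelForm))
    (E X Y : Matrix (Fin 3) (Fin 3) ℝ) :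
    traceForm modelForm (ofMat (E * X - X * E)) (ofMat Y) +
      traceForm modelForm (ofMat X) (ofMat (E * Y - Y * E)) = 0 := by
  let S : Submodule ℝ (Matrix (Fin 3) (Fin 3) ℝ) :=
    { carrier := {E | ∀ X Y, traceForm modelForm (ofMat (E * X - X * E)) (ofMat Y) +
        traceForm modelForm (ofMat X) (ofMat (E * Y - Y * E)) = 0}
      add_mem' := fun {E F} hE hF X Y => by
        simp only [add_mul, mul_add, map_add, map_sub, LinearMap.add_apply,
          LinearMap.sub_apply] at hE hF ⊢
        linear_combination hE X Y + hF X Y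
      zero_mem' := fun X Y => by simp
      smul_mem' := fun r E hE X Y => by
        simp only [smul_mul_assoc, mul_smul_comm, ← smul_sub, map_smul,
          LinearMap.smul_apply, smul_eq_mul]
        linear_combination r * hE X Y }
  have hsq {E : Matrix (Fin 3) (Fin 3) ℝ} (hE : E * E = 0) : E ∈ S :=
    traceForm_commutator_of_sq_eq_zero hnd hE
  have hone : (1 : Matrix (Fin 3) (Fin 3) ℝ) ∈ S := fun X Y => by simp 
  have hoff (i j : Fin 3) (hij : i ≠ j) : Matrix.single i j (1 : ℝ) ∈ S :=
    hsq (by simp [hij.symm])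
  have hdiff (i j : Fin 3) : Matrix.single i i (1 : ℝ) - Matrix.single j j 1 ∈ S := by
    rcases eq_or_ne i j with rfl | hij
    · simp
    have h : Matrix.single i i (1 : ℝ) - Matrix.single j j 1 + Matrix.single i j 1
        - Matrix.single j i 1 ∈ S := by
      apply hsq
      simp [mul_add, add_mul, mul_sub, sub_mul, hij, hij.symm]
      abel
    have := S.add_mem (S.sub_mem h (hoff i j hij)) (hoff j i hij.symm)
    convert this using 1
    abel
  have hdiag (i : Fin 3) : Matrix.single i i (1 : ℝ) ∈ S := by
    have h : Matrix.single i i (1 : ℝ) =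
        (1 / 3 : ℝ) • (1 + ∑ j, (Matrix.single i i (1 : ℝ) - Matrix.single j j 1)) := by
      rw [Finset.sum_sub_distrib, Matrix.sum_single_one]
      simp [← Nat.cast_smul_eq_nsmul ℝ]
    rw [h]
    exact S.smul_mem _ (S.add_mem hone (S.sum_mem fun j _ => hdiff i j))
  have hE : E ∈ S := by
    rw [Matrix.matrix_eq_sum_single E]
    refine S.sum_mem fun i _ => S.sum_mem fun j _ => ?_
    have : Matrix.single i j (E i j) = E i j • Matrix.single i j (1 : ℝ) := by simp
    rw [this]
    refine S.smul_mem _ ?_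
    rcases eq_or_ne i j with rfl | hij
    · exact hdiag i
    · exact hoff i j hij
  exact hE X Y

/-- The commutator of matrices modulo scalars. -/
def modelBracket : 𝕍 →ₗ[ℝ] 𝕍 →ₗ[ℝ] 𝕍 :=
  ((LinearMap.mul ℝ (Matrix (Fin 3) (Fin 3) ℝ) - (LinearMap.mul ℝ _).flip).compl₁₂
    toMat toMat).compr₂ ofMat

theorem modelBracket_ofMat (X Y : Matrix (Fin 3) (Fin 3) ℝ) :
    modelBracket (ofMat X) (ofMat Y) = ofMat (X * Y - Y * X) := by
  simp [modelBracket, toMat_ofMat, mul_sub]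

theorem span_modelBracket :
    Submodule.span ℝ (Set.range fun p : 𝕍 × 𝕍 => modelBracket p.1 p.2) = ⊤ := by
  refine (Submodule.eq_top_iff'.2 fun z => ?_)
  have h (u v : 𝕍) : modelBracket u v ∈
      Submodule.span ℝ (Set.range fun p : 𝕍 × 𝕍 => modelBracket p.1 p.2) :=
    Submodule.subset_span ⟨(u, v), rfl⟩
  have hz : z = modelBracket ![0, 0, 0, 0, 0, 0, 1, 0] ![z 0, 0, -z 2, -z 3, 0, z 5, 0, 0]
      + modelBracket ![0, 0, 0, 0, 0, 0, 0, 1] ![0, z 1, 0, 0, -z 4, 0, 0, 0]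
      + modelBracket ![(2 * z 6 + z 7) / 3, 0, 0, 0, 0, 0, 0, 0] ![0, 0, 0, 1, 0, 0, 0, 0]
      + modelBracket ![0, (z 6 + 2 * z 7) / 3, 0, 0, 0, 0, 0, 0] ![0, 0, 0, 0, 1, 0, 0, 0] := by
    ext i
    fin_cases i <;> simp [modelBracket, toMat, ofMat] <;> ring
  rw [hz]
  exact add_mem (add_mem (add_mem (h _ _) (h _ _)) (h _ _)) (h _ _)

theorem isLieForm_modelForm : IsLieForm modelForm := by
  intro hnd br hbr
  have hsurj : Function.Surjective ofMat := fun x => ⟨_, ofMat_toMat x⟩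
  refine isJacobi_of_invariant hnd hbr (c := modelBracket) ?_ ?_ ?_ ?_ span_modelBracket
  · refine hsurj.forall₂.2 fun X Y => ?_
    rw [modelBracket_ofMat, modelBracket_ofMat, ← map_neg, neg_sub]
  · refine hsurj.forall₃.2 fun W X Y => ?_
    rw [modelBracket_ofMat, modelBracket_ofMat, traceForm_commutator hnd]
  · refine hsurj.forall₃.2 fun W X Y => hsurj.forall.2 fun Z => ?_
    simp only [modelBracket_ofMat, trilin_modelForm_ofMat]
    have h := Matrix.trace_mul_comm W ((X * Y - Y * X) * Z)
    simp only [mul_sub, sub_mul, Matrix.trace_sub, ← mul_assoc] at h ⊢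
    linear_combination h
  · refine hsurj.forall₃.2 fun X Y Z => hsurj.forall.2 fun W => ?_
    simp only [modelBracket_ofMat, trilin_modelForm_ofMat]
    have h := Matrix.trace_mul_comm Z ((X * Y - Y * X) * W)
    simp only [mul_sub, sub_mul, Matrix.trace_sub, ← mul_assoc] at h ⊢
    linear_combination -h

/-- An infinitesimal automorphism of the model form vanishes as soon as eight of its coefficients
do. -/
theorem eq_zero_of_derivation (A : Fin 8 → 𝕍)
    (hA : ∀ i j k : Fin 8, i < j → j < k →
      trilin modelForm (A i) (Pi.single j 1) (Pi.single k 1) +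
      trilin modelForm (Pi.single i 1) (A j) (Pi.single k 1) +
      trilin modelForm (Pi.single i 1) (Pi.single j 1) (A k) = 0)
    (h00 : A 0 0 = 0) (h11 : A 1 1 = 0) (h60 : A 6 0 = 0) (h62 : A 6 2 = 0) (h63 : A 6 3 = 0)
    (h65 : A 6 5 = 0) (h71 : A 7 1 = 0) (h74 : A 7 4 = 0) : A = 0 := by
  simp only [trilin_modelForm, trilin_coordForm] at hA
  have h22 : A 2 2 = 0 := by
    simpa [h00, h11] using hA 0 1 2 (by decide) (by decide)
  have h52 : A 5 2 = 0 := by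
    simpa using hA 0 1 5 (by decide) (by decide)
  have h13 : A 1 3 = 0 := by
    simpa [h62] using hA 0 1 6 (by decide) (by decide)
  have h41 : A 4 1 = 0 := by
    simpa using hA 0 2 4 (by decide) (by decide)
  have h05 : A 0 5 = 0 := by
    simpa [h71] using hA 0 2 7 (by decide) (by decide)
  have h46 : A 4 6 = 0 := by
    simpa [h05] using hA 0 3 4 (by decide) (by decide)
  have h76 : A 7 6 = 0 := by
    simpa using hA 0 3 7 (by decide) (by decide)
  have h03 : A 0 3 = 0 := by
    simpa using hA 0 4 5 (by decide) (by decide)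
  have h43 : A 4 3 = 0 := by
    simpa using hA 0 4 6 (by decide) (by decide)
  have h01 : A 0 1 = 0 := by
    simpa using hA 0 4 7 (by decide) (by decide)
  have h02 : A 0 2 = 0 := by
    simpa using hA 0 5 7 (by decide) (by decide)
  have h73 : A 7 3 = 0 := by
    simpa using hA 0 6 7 (by decide) (by decide)
  have h30 : A 3 0 = 0 := by
    simpa using hA 1 2 3 (by decide) (by decide)
  have h15 : A 1 5 = 0 := by
    simpa [h60] using hA 1 2 6 (by decide) (by decide)
  have h37 : A 3 7 = 0 := by
    simpa [h15] using hA 1 3 4 (by decide) (by decide)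
  have h14 : A 1 4 = 0 := by
    simpa using hA 1 3 5 (by decide) (by decide)
  have h10 : A 1 0 = 0 := by
    simpa using hA 1 3 6 (by decide) (by decide)
  have h34 : A 3 4 = 0 := by
    simpa using hA 1 3 7 (by decide) (by decide)
  have h57 : A 5 7 = 0 := by
    simpa [h13] using hA 1 4 5 (by decide) (by decide)
  have h67 : A 6 7 = 0 := by
    simpa using hA 1 4 6 (by decide) (by decide)
  have h12 : A 1 2 = 0 := by
    simpa using hA 1 5 6 (by decide) (by decide)
  have h54 : A 5 4 = 0 := by
    simpa [h12] using hA 1 5 7 (by decide) (by decide)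
  have h64 : A 6 4 = 0 := by
    simpa using hA 1 6 7 (by decide) (by decide)
  have h25 : A 2 5 = 0 := by
    simpa using hA 2 3 4 (by decide) (by decide)
  have h35 : A 3 5 = 0 := by
    simpa using hA 2 3 7 (by decide) (by decide)
  have h45 : A 4 5 = 0 := by
    simpa using hA 2 4 6 (by decide) (by decide)
  have h21 : A 2 1 = 0 := by
    simpa [h45] using hA 2 4 7 (by decide) (by decide)
  have h75 : A 7 5 = 0 := by
    simpa [h65] using hA 2 6 7 (by decide) (by decide)
  have h40 : A 4 0 = 0 := by
    simpa [h65] using hA 3 4 6 (by decide) (by decide)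
  have h31 : A 3 1 = 0 := by
    simpa [h75] using hA 3 4 7 (by decide) (by decide)
  have h32 : A 3 2 = 0 := by
    simpa [h74] using hA 3 5 7 (by decide) (by decide)
  have h70 : A 7 0 = 0 := by
    simpa using hA 3 6 7 (by decide) (by decide)
  have h42 : A 4 2 = 0 := by
    simpa [h63] using hA 4 5 6 (by decide) (by decide)
  have h51 : A 5 1 = 0 := by
    simpa [h42, h73] using hA 4 5 7 (by decide) (by decide)
  have h61 : A 6 1 = 0 := by
    simpa using hA 4 6 7 (by decide) (by decide)
  have h72 : A 7 2 = 0 := by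
    simpa [h62] using hA 5 6 7 (by decide) (by decide)
  have h16 : A 1 6 = 0 := by
    simpa [h32] using hA 0 1 3 (by decide) (by decide)
  have h07 : A 0 7 = 0 := by
    simpa [h42] using hA 0 1 4 (by decide) (by decide)
  have h04 : A 0 4 = 0 := by
    simpa [h72] using hA 0 1 7 (by decide) (by decide)
  have h26 : A 2 6 = 0 := by
    simpa [h31] using hA 0 2 3 (by decide) (by decide)
  have h06 : A 0 6 = 0 := by
    simpa [h51, h07] using hA 0 2 5 (by decide) (by decide)
  have h23 : A 2 3 = 0 := by
    simpa [h61, h05] using hA 0 2 6 (by decide) (by decide)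
  have h56 : A 5 6 = 0 := by
    simpa [h04] using hA 0 3 5 (by decide) (by decide)
  have h53 : A 5 3 = 0 := by
    simpa [h02] using hA 0 5 6 (by decide) (by decide)
  have h27 : A 2 7 = 0 := by
    simpa [h40] using hA 1 2 4 (by decide) (by decide)
  have h24 : A 2 4 = 0 := by
    simpa [h70, h15] using hA 1 2 7 (by decide) (by decide)
  have h36 : A 3 6 = 0 := by
    simpa [h24, h37] using hA 2 3 5 (by decide) (by decide)
  have h20 : A 2 0 = 0 := by
    simpa [h35] using hA 2 3 6 (by decide) (by decide)
  have h47 : A 4 7 = 0 := by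
    simpa [h23, h46] using hA 2 4 5 (by decide) (by decide)
  have h50 : A 5 0 = 0 := by
    simpa [h32, h64] using hA 3 5 6 (by decide) (by decide)
  have h17 : A 1 7 = 0 := by
    simpa [h50, h16] using hA 1 2 5 (by decide) (by decide)
  have e036 := hA 0 3 6 (by decide) (by decide)
  have e147 := hA 1 4 7 (by decide) (by decide)
  have e256 := hA 2 5 6 (by decide) (by decide)
  have e257 := hA 2 5 7 (by decide) (by decide)
  have e345 := hA 3 4 5 (by decide) (by decide)
  simp [h00, h11, h22, h67, h76] at e036 e147 e256 e257 e345
  have h33 : A 3 3 = 0 := by linarith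
  have h44 : A 4 4 = 0 := by linarith
  have h55 : A 5 5 = 0 := by linarith
  have h66 : A 6 6 = 0 := by linarith
  have h77 : A 7 7 = 0 := by linarith
  ext i j
  fin_cases i <;> fin_cases j <;> assumption

theorem continuous_modelForm : Continuous modelForm := by
  have h (i j k : Fin 8) : Continuous (coordForm i j k) := by
    have : Continuous fun v : Fin 3 → 𝕍 => Matrix.det (Matrix.of fun a b => v a (![i, j, k] b)) :=
      Continuous.matrix_det (by fun_prop)
    exact this
  exact ((((h 0 1 2).sub (h 3 4 5)).add (h 0 3 6)).add (h 1 4 7)).sub (h 2 5 6) |>.sub (h 2 5 7)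

/-- The model form as a continuous multilinear map. -/
def modelFormL : ContinuousMultilinearMap ℝ (fun _ : Fin 3 => 𝕍) ℝ where
  toMultilinearMap := modelForm.toMultilinearMap
  cont := continuous_modelForm

/-- The increasing triples of indices. -/
abbrev Triple : Type := {s : Fin 3 → Fin 8 // StrictMono s}

theorem card_triple : Fintype.card Triple = 56 := by decide +kernel

theorem form_ext_triple {φ ψ : 𝕍 [⋀^Fin 3]→ₗ[ℝ] ℝ}
    (h : ∀ s : Triple, (φ fun m => Pi.single (s.1 m) 1) = ψ fun m => Pi.single (s.1 m) 1) :
    φ = ψ := by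
  refine (Pi.basisFun ℝ (Fin 8)).ext_alternating fun v hv => ?_
  have hs := h ⟨v ∘ Tuple.sort v, (Tuple.monotone_sort v).strictMono_of_injective
    (hv.comp (Tuple.sort v).injective)⟩
  have hv' : (fun m => (Pi.single ((v ∘ Tuple.sort v) m) 1 : 𝕍)) =
      (fun i => Pi.basisFun ℝ (Fin 8) (v i)) ∘ Tuple.sort v := by
    funext m
    simp
  rw [hv', map_perm, map_perm] at hs
  exact smul_left_cancel _ hs

/-- The coefficients of the pull-back of the model form by the linear map with columns `a`. -/
def pullbackCoeff (a : Fin 8 → 𝕍) (s : Triple) : ℝ := modelForm fun m => a (s.1 m)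

/-- The derivative of `pullbackCoeff` at the identity. -/
def pullbackDeriv : (Fin 8 → 𝕍) →L[ℝ] (Triple → ℝ) :=
  ContinuousLinearMap.pi fun s =>
    (modelFormL.linearDeriv fun m => Pi.single (s.1 m) 1) ∘L
      ContinuousLinearMap.pi fun m => ContinuousLinearMap.proj (s.1 m)

theorem hasStrictFDerivAt_pullbackCoeff :
    HasStrictFDerivAt pullbackCoeff pullbackDeriv fun i => Pi.single i 1 := by
  refine hasStrictFDerivAt_pi.2 fun s => ?_
  let p : (Fin 8 → 𝕍) →L[ℝ] (Fin 3 → 𝕍) :=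
    ContinuousLinearMap.pi fun m => ContinuousLinearMap.proj (s.1 m)
  exact (modelFormL.hasStrictFDerivAt (p fun i => Pi.single i 1)).comp _ p.hasStrictFDerivAt

theorem pullbackDeriv_apply (A : Fin 8 → 𝕍) (s : Triple) :
    pullbackDeriv A s =
      trilin modelForm (A (s.1 0)) (Pi.single (s.1 1) 1) (Pi.single (s.1 2) 1) +
      trilin modelForm (Pi.single (s.1 0) 1) (A (s.1 1)) (Pi.single (s.1 2) 1) +
      trilin modelForm (Pi.single (s.1 0) 1) (Pi.single (s.1 1) 1) (A (s.1 2)) := by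
  have : pullbackDeriv A s = modelFormL.linearDeriv (fun m => Pi.single (s.1 m) 1)
      fun m => A (s.1 m) := rfl
  rw [this, ContinuousMultilinearMap.linearDeriv_apply, Fin.sum_univ_three]
  refine congr_arg₂ _ (congr_arg₂ _ ?_ ?_) ?_ <;>
  · refine congr_arg modelForm (funext fun m => ?_)
    fin_cases m <;> simp

theorem range_pullbackDeriv : pullbackDeriv.range = ⊤ := by
  let N : (Fin 8 → 𝕍) →ₗ[ℝ] 𝕍 :=
    LinearMap.pi fun i => LinearMap.proj (![0, 1, 0, 2, 3, 5, 1, 4] i) ∘ₗ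
      LinearMap.proj (![0, 1, 6, 6, 6, 6, 7, 7] i)
  have hN (A : Fin 8 → 𝕍) (i : Fin 8) :
      N A i = A (![0, 1, 6, 6, 6, 6, 7, 7] i) (![0, 1, 0, 2, 3, 5, 1, 4] i) := rfl
  have hinj : Function.Injective (pullbackDeriv.toLinearMap.prod N) := by
    refine LinearMap.ker_eq_bot.1 (LinearMap.ker_eq_bot'.2 fun A hA => ?_)
    obtain ⟨hD, hNA⟩ := Prod.mk.inj hA
    have h (i : Fin 8) := (hN A i).symm.trans (congr_fun hNA i)
    refine eq_zero_of_derivation A (fun i j k hij hjk => ?_) (h 0) (h 1) (h 2) (h 3) (h 4) (h 5)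
      (h 6) (h 7)
    have hs : StrictMono ![i, j, k] := Fin.strictMono_iff_lt_succ.2 fun m => by
      fin_cases m <;> assumption
    exact (pullbackDeriv_apply A ⟨_, hs⟩).symm.trans (congr_fun hD _)
  have hsurj := (LinearMap.injective_iff_surjective_of_finrank_eq_finrank (by
    simp [card_triple, Module.finrank_pi_fintype])).1 hinj
  refine LinearMap.range_eq_top.2 fun y => ?_
  obtain ⟨A, hA⟩ := hsurj (y, 0)
  exact ⟨A, congr_arg Prod.fst hA⟩

/-- All `3`-forms close to the model form on a line are equivalent to it. -/
theorem eventually_equiv_modelForm (ψ : 𝕍 [⋀^Fin 3]→ₗ[ℝ] ℝ) :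
    ∀ᶠ t : ℝ in nhds 0, ∃ g : 𝕍 ≃ₗ[ℝ] 𝕍,
      modelForm + t • ψ = modelForm.compLinearMap g.toLinearMap := by
  let e : Fin 8 → 𝕍 := fun i => Pi.single i 1
  have hU : {a : Fin 8 → 𝕍 | (Matrix.of a).det ≠ 0} ∈ nhds e := by
    refine IsOpen.mem_nhds (isOpen_ne_fun (Continuous.matrix_det (by fun_prop))
      continuous_const) ?_
    have : Matrix.of e = (1 : Matrix (Fin 8) (Fin 8) ℝ) := by
      ext i j
      simp [e, Matrix.one_apply, Pi.single_apply, eq_comm]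
    simp [this]
  have hV := Filter.image_mem_map (m := pullbackCoeff) hU
  rw [hasStrictFDerivAt_pullbackCoeff.map_nhds_eq_of_surj range_pullbackDeriv] at hV
  let c : ℝ → Triple → ℝ := fun t s => modelForm (fun m => e (s.1 m)) + t * ψ fun m => e (s.1 m)
  have hc : Filter.Tendsto c (nhds 0) (nhds (pullbackCoeff e)) := by
    have : pullbackCoeff e = c 0 := by
      funext s
      simp [c, pullbackCoeff]
    rw [this]
    exact Continuous.tendsto (by fun_prop) 0
  filter_upwards [hc hV] with t ⟨a, ha, hat⟩
  let A : 𝕍 →ₗ[ℝ] 𝕍 := Matrix.toLin' (Matrix.of a).transpose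
  have hA : LinearMap.det A ≠ 0 := by
    rwa [LinearMap.det_toLin', Matrix.det_transpose]
  have hAe (i : Fin 8) : A (Pi.single i 1) = a i := by
    ext j
    simp [A]
  refine ⟨LinearMap.equivOfDetNeZero A hA, form_ext_triple fun s => ?_⟩
  have h : modelForm (fun m => a (s.1 m)) = c t s := congr_fun hat s
  have hg : (LinearMap.equivOfDetNeZero A hA).toLinearMap = A := rfl
  rw [hg, compLinearMap_apply]
  simp only [hAe, h]
  rfl

section Line

open Polynomial

theorem reducedMul_line (φ ψ : 𝕍 [⋀^Fin 3]→ₗ[ℝ] ℝ) (t : ℝ) :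
    reducedMul (φ + t • ψ) = polarMul φ φ φ +
      t • (polarMul ψ φ φ + polarMul φ ψ φ + polarMul φ φ ψ) +
      t ^ 2 • (polarMul ψ ψ φ + polarMul ψ φ ψ + polarMul φ ψ ψ) + t ^ 3 • polarMul ψ ψ ψ := by
  refine LinearMap.ext₂ fun v w => ?_
  simp only [reducedMul, LinearMap.add_apply, LinearMap.smul_apply, polarMul_apply,
    ← awedgeBilin_apply, curryLeft_add, curryLeft_smul, map_add, map_smul]
  module

theorem exists_polynomial_mulCoeff (φ ψ : 𝕍 [⋀^Fin 3]→ₗ[ℝ] ℝ) :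
    ∃ P : Fin 8 → Fin 8 → Fin 8 → ℝ[X], ∀ t i j k,
      mulCoeff (φ + t • ψ) i j k = (P i j k).eval t := by
  let a (m : 𝕍 →ₗ[ℝ] 𝕍 →ₗ[ℝ] 𝕍) (i j k : Fin 8) : ℝ[X] :=
    C (m (Pi.single i 1) (Pi.single j 1) k)
  refine ⟨fun i j k => a (polarMul φ φ φ) i j k +
    X * a (polarMul ψ φ φ + polarMul φ ψ φ + polarMul φ φ ψ) i j k +
    X ^ 2 * a (polarMul ψ ψ φ + polarMul ψ φ ψ + polarMul φ ψ ψ) i j k +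
    X ^ 3 * a (polarMul ψ ψ ψ) i j k, fun t i j k => ?_⟩
  rw [mulCoeff, reducedMul_line]
  simp [a]
  ring

theorem exists_polynomial_formCoeff (φ ψ : 𝕍 [⋀^Fin 3]→ₗ[ℝ] ℝ) :
    ∃ P : Fin 8 → Fin 8 → Fin 8 → ℝ[X], ∀ t i j k,
      formCoeff (φ + t • ψ) i j k = (P i j k).eval t := by
  refine ⟨fun i j k => C (formCoeff φ i j k) + X * C (formCoeff ψ i j k), fun t i j k => ?_⟩
  simp only [eval_add, eval_mul, eval_C, eval_X]
  rfl

theorem IsLieForm.of_eventually {φ ψ : 𝕍 [⋀^Fin 3]→ₗ[ℝ] ℝ}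
    (h : ∀ᶠ t : ℝ in nhds 0, IsLieForm (φ + t • ψ)) (t : ℝ) : IsLieForm (φ + t • ψ) := by
  obtain ⟨P, hP⟩ := exists_polynomial_mulCoeff φ ψ
  obtain ⟨Q, hQ⟩ := exists_polynomial_formCoeff φ ψ
  have hJ (t : ℝ) (i j k l : Fin 8) : (jacobiPoly P Q i j k l).eval t =
      jacobiPoly (mulCoeff (φ + t • ψ)) (formCoeff (φ + t • ψ)) i j k l := by
    have hP' : mulCoeff (φ + t • ψ) = fun i j k => evalRingHom t (P i j k) := by
      ext; exact hP _ _ _ _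
    have hQ' : formCoeff (φ + t • ψ) = fun i j k => evalRingHom t (Q i j k) := by
      ext; exact hQ _ _ _ _
    rw [hP', hQ', ← map_jacobiPoly, coe_evalRingHom]
  refine (isLieForm_iff _).2 fun i j k l => ?_
  have h0 : jacobiPoly P Q i j k l = 0 := by
    refine eq_zero_of_infinite_isRoot _ (infinite_of_mem_nhds (0 : ℝ) ?_)
    filter_upwards [h] with s hs
    exact (hJ s i j k l).trans ((isLieForm_iff _).1 hs i j k l)
  rw [← hJ, h0, eval_zero]

end Line

theorem isLieForm (φ : 𝕍 [⋀^Fin 3]→ₗ[ℝ] ℝ) : IsLieForm φ := by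
  have h := IsLieForm.of_eventually (φ := modelForm) (ψ := φ - modelForm) (by
    filter_upwards [eventually_equiv_modelForm (φ - modelForm)] with t ⟨g, hg⟩
    rw [hg]
    exact isLieForm_modelForm.compLinearMap g) 1
  rwa [one_smul, add_sub_cancel] at h

/-- If `φ` is a 3-form on `ℝ⁸` with non-degenerate reduced trace form `b^φ`, then the
bracket defined by `b^φ([X,Y], Z) = φ(X,Y,Z)` is antisymmetric and satisfies the Jacobi
identity, i.e. it makes `ℝ⁸` a Lie algebra. -/
theorem bracket_lie_algebra (φ : (Fin 8 → ℝ) [⋀^Fin 3]→ₗ[ℝ] ℝ)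
    (mul : (Fin 8 → ℝ) →ₗ[ℝ] (Fin 8 → ℝ) →ₗ[ℝ] (Fin 8 → ℝ)) (hmul : IsReducedMul φ mul)
    (hnd : ∀ v : Fin 8 → ℝ, (∀ w : Fin 8 → ℝ, reducedTraceForm mul v w = 0) → v = 0)
    (bracket : (Fin 8 → ℝ) →ₗ[ℝ] (Fin 8 → ℝ) →ₗ[ℝ] (Fin 8 → ℝ))
    (hbr : ∀ X Y Z : Fin 8 → ℝ, reducedTraceForm mul (bracket X Y) Z = φ ![X, Y, Z]) :
    (∀ X Y : Fin 8 → ℝ, bracket X Y = -bracket Y X) ∧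
    (∀ X Y Z : Fin 8 → ℝ,
      bracket X (bracket Y Z) + bracket Y (bracket Z X) + bracket Z (bracket X Y) = 0) := by
  obtain rfl := isReducedMul_iff.1 hmul
  refine ⟨fun X Y => IsNondeg.ext (b := traceForm φ) hnd fun Z => ?_,
    isLieForm φ hnd bracket hbr⟩
  rw [map_neg, LinearMap.neg_apply, traceForm_apply, traceForm_apply, hbr, hbr, ← trilin_apply,
    ← trilin_apply, trilin_swap]
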